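/- arXiv:2505.09719 — 2 statements merged into one kernel-verified Lean document; each statement's English description precedes it below -/
import Mathlib

section
/- Let G be a finite connected loopless graph with at least two vertices. Then φ_pcan is generic: for every nontrivial biconnected subset W ⊆ V(G), the real number Σ_{v∈W} φ_pcan(v) − |E(W,W^c)|/2 is not an integer. -/
open Finset

open scoped Classical

section MultiGraph

variable {V E : Type*} [Fintype V] [Fintype E] [DecidableEq V] [DecidableEq E]

/-- Degree of a vertex in the loopless multigraph with edge-endpoint maps `s`, `t`. -/
def deg (s t : E → V) (v : V) : ℕ :=
  (Finset.univ.filter fun e => s e = v).card + (Finset.univ.filter fun e => t e = v).card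

/-- Edges with both endpoints in `W` (edge set of the induced subgraph `G[W]`). -/
def inEdges (s t : E → V) (W : Finset V) : Finset E :=
  Finset.univ.filter fun e => s e ∈ W ∧ t e ∈ W

/-- Edges with exactly one endpoint in `W` (the cut `E(W, Wᶜ)`). -/
def cutEdges (s t : E → V) (W : Finset V) : Finset E :=
  Finset.univ.filter fun e => (s e ∈ W ∧ t e ∉ W) ∨ (s e ∉ W ∧ t e ∈ W)

/-- Edges with one endpoint in `A` and the other in `B`. -/
def betweenEdges (s t : E → V) (A B : Finset V) : Finset E :=
  Finset.univ.filter fun e => (s e ∈ A ∧ t e ∈ B) ∨ (s e ∈ B ∧ t e ∈ A)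

/-- Reachability using only edges in `F`. -/
def Reach (s t : E → V) (F : Finset E) (a b : V) : Prop :=
  Relation.ReflTransGen (fun x y => ∃ e ∈ F, (s e = x ∧ t e = y) ∨ (s e = y ∧ t e = x)) a b

/-- The vertex set `W` is nonempty and connected using the edges in `F`. -/
def ConnOn (s t : E → V) (F : Finset E) (W : Finset V) : Prop :=
  W.Nonempty ∧ ∀ a ∈ W, ∀ b ∈ W, Reach s t F a b

/-- The induced subgraph `G[W]` is connected. -/
def IndConn (s t : E → V) (W : Finset V) : Prop :=
  ConnOn s t (inEdges s t W) W

/-- `W` is biconnected: both `G[W]` and `G[Wᶜ]` are connected (hence `W` is nontrivial). -/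
def Biconn (s t : E → V) (W : Finset V) : Prop :=
  IndConn s t W ∧ IndConn s t Wᶜ

/-- The genus `g(G) = |E| - |V| + 1` of the multigraph. -/
def genus (_s _t : E → V) : ℤ := (Fintype.card E : ℤ) - Fintype.card V + 1

/-- The genus `g(G[W]) = |E(G[W])| - |W| + 1` of the induced subgraph on `W`. -/
def indGenus (s t : E → V) (W : Finset V) : ℤ := ((inEdges s t W).card : ℤ) - W.card + 1

/-- The polarization `φ_pcan(v) = ((|E|+1)/(2|E|))·deg(v) − 1`. -/
noncomputable def pcan (s t : E → V) (v : V) : ℝ :=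
  ((Fintype.card E + 1 : ℝ) / (2 * Fintype.card E)) * deg s t v - 1

/-- A spanning tree: a connected spanning subgraph with `|V| - 1` edges. -/
def IsSpanningTree (s t : E → V) (T : Finset E) : Prop :=
  ConnOn s t T Finset.univ ∧ T.card + 1 = Fintype.card V

/-- For `e ∈ T`, the vertex set of the component of `T ∖ e` containing `s e`. -/
noncomputable def treeSide (s t : E → V) (T : Finset E) (e : E) : Finset V :=
  Finset.univ.filter fun v => Reach s t (T.erase e) (s e) v

/-- The head of the edge `e` under the orientation `o`
(`o e = true` means `e` is directed from `s e` to `t e`, i.e. as in the reference orientation). -/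
def ohead (s t : E → V) (o : E → Bool) (e : E) : V := if o e then t e else s e

/-- A cocycle signature, encoded as a choice, for each `W`, of a coherent orientation of the
cut `E(W,Wᶜ)`: `σ W = true` means all edges of the cut are directed towards `W`. -/
def IsSignature (s t : E → V) (σ : Finset V → Bool) : Prop :=
  ∀ W : Finset V, Biconn s t W → σ Wᶜ = ! σ W

/-- The orientation `T⃗*_σ` of a spanning tree `T`: each `e ∈ T` is directed as it is in
`σ(C*(T,e))`, where `C*(T,e)` is the fundamental cocycle `E(W_e, W_eᶜ)` with `W_e ∋ s e`. -/
noncomputable def sigmaOrient (s t : E → V) (σ : Finset V → Bool) (T : Finset E) : E → Bool :=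
  fun e => ! σ (treeSide s t T e)

/-- `σ` is triangulating: for every spanning tree `T`, every cocycle `E(W,Wᶜ)` (for biconnected
`W`) and every coherent orientation of it (towards `W` iff `b`), if every edge of the cocycle
lying in `T` is directed in `σ(C*(T,e))` the same way as in that coherent orientation, then `σ`
assigns that orientation to the cocycle. -/
noncomputable def Triangulating (s t : E → V) (σ : Finset V → Bool) : Prop :=
  ∀ T : Finset E, IsSpanningTree s t T → ∀ W : Finset V, Biconn s t W → ∀ b : Bool,
    (∀ e ∈ cutEdges s t W ∩ T, (ohead s t (sigmaOrient s t σ T) e ∈ W ↔ b = true)) →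
    σ W = b

/-- The vector in `ℝ^E` associated to the coherently oriented cocycle `σ(E(W,Wᶜ))`:
`+1` on edges directed as in the reference orientation, `-1` on edges directed oppositely,
`0` off the cocycle. -/
noncomputable def cocycVec (s t : E → V) (σ : Finset V → Bool) (W : Finset V) : E → ℝ :=
  fun e =>
    if s e ∈ W ∧ t e ∉ W then (if σ W then -1 else 1)
    else if s e ∉ W ∧ t e ∈ W then (if σ W then 1 else -1)
    else 0

/-- `σ` is acyclic: the only nonnegative reals `a_W`, supported on the (biconnected) cocycles,
with `Σ_W a_W · σ(E(W,Wᶜ)) = 0` in `ℝ^E` are all zero. -/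
def AcyclicSig (s t : E → V) (σ : Finset V → Bool) : Prop :=
  ∀ a : Finset V → ℝ, (∀ W, 0 ≤ a W) → (∀ W, ¬ Biconn s t W → a W = 0) →
    (∑ W : Finset V, a W • cocycVec s t σ W) = 0 → ∀ W, a W = 0

/-- The degree-zero divisor `I_G^σ(T)(v) = indeg_{T⃗*_σ}(v) − 1 + [v = q]`. -/
noncomputable def IG (s t : E → V) (σ : Finset V → Bool) (q : V) (T : Finset E) : V → ℤ :=
  fun v => ((T.filter fun e => ohead s t (sigmaOrient s t σ T) e = v).card : ℤ) - 1
    + (if v = q then 1 else 0)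

/-- The break divisor `D(T, O_E)`: its value at `v` is the number of edges outside `T`
whose head under the orientation `o` is `v`. -/
def breakDiv (s t : E → V) (T : Finset E) (o : E → Bool) : V → ℤ :=
  fun v => ((Finset.univ.filter fun e => e ∉ T ∧ ohead s t o e = v).card : ℤ)

/-- The set of generalized break divisors `BD_{I_G^σ}(G)`. -/
noncomputable def BDset (s t : E → V) (σ : Finset V → Bool) (q : V) : Set (V → ℤ) :=
  { D | ∃ T : Finset E, ∃ o : E → Bool, IsSpanningTree s t T ∧
      D = fun v => breakDiv s t T o v + IG s t σ q T v }

/-- The graph Laplacian acting on `ℤ^V`. -/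
def lap (s t : E → V) (f : V → ℤ) : V → ℤ :=
  fun v => ∑ e : E, ((if s e = v then 1 else 0) - (if t e = v then 1 else 0)) * (f (s e) - f (t e))

/-- Linear (chip-firing) equivalence of divisors. -/
def LinEquiv (s t : E → V) (D D' : V → ℤ) : Prop :=
  ∃ f : V → ℤ, ∀ v, D v - D' v = lap s t f v

/-- A numerical polarization `φ` is generic if `φ_W − |E(W,Wᶜ)|/2 ∉ ℤ` for every
nontrivial biconnected `W`. -/
def Generic (s t : E → V) (φ : V → ℝ) : Prop :=
  ∀ W : Finset V, Biconn s t W →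
    ∀ n : ℤ, (∑ v ∈ W, φ v) - (cutEdges s t W).card / 2 ≠ (n : ℝ)

/-- `n(φ)_W = ⌈φ_W − |E(W,Wᶜ)|/2⌉`. -/
noncomputable def nphi (s t : E → V) (φ : V → ℝ) (W : Finset V) : ℤ :=
  ⌈(∑ v ∈ W, φ v) - (cutEdges s t W).card / 2⌉

end MultiGraph

theorem sum_deg_eq {V E : Type*} [Fintype E] [DecidableEq V] (s t : E → V) (W : Finset V) :
    ∑ v ∈ W, deg s t v = 2 * (inEdges s t W).card + (cutEdges s t W).card := by
  simp only [deg, inEdges, cutEdges, Finset.card_filter, Finset.sum_add_distrib]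
  rw [Finset.sum_comm, Finset.sum_comm (s := W) (t := Finset.univ), Finset.mul_sum,
    ← Finset.sum_add_distrib, ← Finset.sum_add_distrib]
  refine Finset.sum_congr rfl fun e _ => ?_
  simp only [Finset.sum_ite_eq]
  by_cases hs : s e ∈ W <;> by_cases ht : t e ∈ W <;> simp [hs, ht]

theorem card_inEdges_add_card_cutEdges_le {V E : Type*} [Fintype E] [DecidableEq V]
    [DecidableEq E] (s t : E → V) (W : Finset V) :
    (inEdges s t W).card + (cutEdges s t W).card ≤ Fintype.card E := by
  rw [← Finset.card_union_of_disjoint]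
  · exact Finset.card_le_univ _
  · rw [Finset.disjoint_left]
    intro e he hc
    simp only [inEdges, cutEdges, Finset.mem_filter] at he hc
    tauto

/-- A path leaving `W` uses an edge of the cut. -/
theorem Reach.cutEdges_nonempty {V E : Type*} [Fintype E] [DecidableEq V]
    {s t : E → V} {F : Finset E} {W : Finset V} {a b : V}
    (h : Reach s t F a b) (ha : a ∈ W) (hb : b ∉ W) : (cutEdges s t W).Nonempty := by
  by_contra hne
  refine hb ?_
  clear hb
  induction h with
  | refl => exact ha
  | tail _ hstep ih =>
    obtain ⟨e, -, he⟩ := hstep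
    by_contra hc
    refine hne ⟨e, ?_⟩
    rcases he with ⟨rfl, rfl⟩ | ⟨rfl, rfl⟩ <;> simp [cutEdges, hc, ih]

section Statements

variable {V E : Type*} [Fintype V] [Fintype E] [DecidableEq V] [DecidableEq E]

/-- `φ_pcan` is generic: for every nontrivial biconnected `W`,
`Σ_{v∈W} φ_pcan(v) − |E(W,Wᶜ)|/2` is not an integer. -/
theorem stmt_3 (s t : E → V) (hloop : ∀ e, s e ≠ t e)
    (hconn : ConnOn s t Finset.univ Finset.univ) (hcard : 2 ≤ Fintype.card V)
    (W : Finset V) (hW : W.Nonempty) (hWc : Wᶜ.Nonempty) (hbi : Biconn s t W) :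
    ∀ n : ℤ, (∑ v ∈ W, pcan s t v) - (cutEdges s t W).card / 2 ≠ (n : ℝ) := by
  intro n hn
  obtain ⟨a, ha⟩ := hW
  obtain ⟨b, hb⟩ := hWc
  have hcut : 0 < (cutEdges s t W).card :=
    ((hconn.2 a (Finset.mem_univ a) b (Finset.mem_univ b)).cutEdges_nonempty ha
      (Finset.mem_compl.mp hb)).card_pos
  have hle := card_inEdges_add_card_cutEdges_le s t W
  have hdeg : (∑ v ∈ W, (deg s t v : ℝ)) =
      2 * (inEdges s t W).card + (cutEdges s t W).card := by
    exact_mod_cast sum_deg_eq s t W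
  simp only [pcan, Finset.sum_sub_distrib, ← Finset.mul_sum, hdeg, Finset.sum_const,
    nsmul_eq_mul, mul_one] at hn
  generalize (inEdges s t W).card = i at *
  generalize (cutEdges s t W).card = c at *
  generalize Fintype.card E = m at *
  have hm : (m : ℝ) ≠ 0 := by
    have : m ≠ 0 := by omega
    exact_mod_cast this
  field_simp at hn
  have hreal : (2 * i + c : ℝ) = 2 * m * (n - i + W.card) := by linarith
  have hint : (2 * i + c : ℤ) = 2 * m * (n - i + W.card) := by exact_mod_cast hreal
  have hpos : 0 < n - i + W.card := by
    by_contra! h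
    nlinarith
  have hlt : n - i + W.card < 1 := by
    by_contra! h
    nlinarith
  omega

end Statements
end

section
/- Let G be a finite connected loopless graph of genus g = |E(G)| − |V(G)| + 1, let q ∈ V(G), and let σ* be a triangulating cocycle signature of G. Then the set of generalized break divisors BD_{I_G^{σ*}}(G) is a complete set of representatives for linear equivalence of divisors of degree g: every divisor on G of degree g is linearly equivalent to exactly one element of BD_{I_G^{σ*}}(G). -/
open Finset

open scoped Classical

set_option linter.unusedSectionVars false

section Connectivity

variable {V E : Type*} [Fintype V] [Fintype E] [DecidableEq V] [DecidableEq E]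
variable {s t : E → V}

lemma Reach.of_mem {F : Finset E} {e : E} (he : e ∈ F) : Reach s t F (s e) (t e) :=
  Relation.ReflTransGen.single ⟨e, he, Or.inl ⟨rfl, rfl⟩⟩

lemma Reach.symm {F : Finset E} {a b : V} (h : Reach s t F a b) : Reach s t F b a := by
  induction h with
  | refl => exact Relation.ReflTransGen.refl
  | tail _ hbc ih =>
    obtain ⟨e, he, h⟩ := hbc
    exact ih.head ⟨e, he, h.symm⟩

lemma Reach.trans {F : Finset E} {a b c : V} (h : Reach s t F a b) (h' : Reach s t F b c) :
    Reach s t F a c :=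
  Relation.ReflTransGen.trans h h'

lemma Reach.mono {F F' : Finset E} (hF : F ⊆ F') {a b : V} (h : Reach s t F a b) :
    Reach s t F' a b := by
  induction h with
  | refl => exact Relation.ReflTransGen.refl
  | tail _ hbc ih =>
    obtain ⟨e, he, h⟩ := hbc
    exact ih.tail ⟨e, hF he, h⟩

lemma Reach.exists_crossing {F : Finset E} {a b : V} (h : Reach s t F a b) {X : Finset V}
    (ha : a ∈ X) (hb : b ∉ X) :
    ∃ e ∈ F, (s e ∈ X ∧ t e ∉ X) ∨ (s e ∉ X ∧ t e ∈ X) := by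
  by_contra! hcon
  refine hb ?_
  induction h with
  | refl => exact ha
  | tail _ hstep ih =>
    obtain ⟨e, he, h⟩ := hstep
    have := hcon e he
    by_contra hc
    rcases h with ⟨rfl, rfl⟩ | ⟨rfl, rfl⟩ <;> tauto

lemma ConnOn.exists_crossing {F : Finset E} (h : ConnOn s t F univ) {X : Finset V} {a b : V}
    (ha : a ∈ X) (hb : b ∉ X) :
    ∃ e ∈ F, (s e ∈ X ∧ t e ∉ X) ∨ (s e ∉ X ∧ t e ∈ X) :=
  (h.2 a (mem_univ a) b (mem_univ b)).exists_crossing ha hb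

lemma connOn_of_reach {F : Finset E} {W : Finset V} {a : V} (ha : a ∈ W)
    (h : ∀ v ∈ W, Reach s t F a v) : ConnOn s t F W :=
  ⟨⟨a, ha⟩, fun x hx y hy => (h x hx).symm.trans (h y hy)⟩

/-- The connected component of `a` in the induced subgraph `G[W]`. -/
lemma exists_component (s t : E → V) {W : Finset V} {a : V} (ha : a ∈ W) :
    ∃ A ⊆ W, a ∈ A ∧ IndConn s t A ∧ ∀ e, s e ∈ W → t e ∈ W → (s e ∈ A ↔ t e ∈ A) := by
  set A : Finset V := univ.filter fun v => Reach s t (inEdges s t W) a v with hA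
  have hmem : ∀ v, v ∈ A ↔ Reach s t (inEdges s t W) a v := by simp [hA]
  have haA : a ∈ A := (hmem a).2 Relation.ReflTransGen.refl
  refine ⟨A, fun v hv => ?_, haA, connOn_of_reach haA fun v hv => ?_, fun e hs ht => ?_⟩
  · by_contra hvW
    obtain ⟨e, he, h⟩ := ((hmem v).1 hv).exists_crossing ha hvW
    simp only [inEdges, mem_filter] at he
    tauto
  · have hv' := (hmem v).1 hv
    clear hv
    induction hv' with
    | refl => exact Relation.ReflTransGen.refl
    | @tail b c hab hbc ih =>
      have hb : b ∈ A := (hmem b).2 hab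
      have hc : c ∈ A := (hmem c).2 (hab.tail hbc)
      obtain ⟨e, -, h⟩ := hbc
      refine ih.tail ⟨e, ?_, h⟩
      rcases h with ⟨rfl, rfl⟩ | ⟨rfl, rfl⟩ <;> simp [inEdges, hb, hc]
  · have he : e ∈ inEdges s t W := by simp [inEdges, hs, ht]
    rw [hmem, hmem]
    exact ⟨fun h => h.trans (Reach.of_mem he), fun h => h.trans (Reach.of_mem he).symm⟩

/-- Every nontrivial cut contains a cocycle, directed compatibly. -/
lemma exists_biconn (hconn : ConnOn s t univ univ) {W : Finset V} {a b : V}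
    (ha : a ∈ W) (hb : b ∉ W) :
    ∃ W', Biconn s t W' ∧ ∀ e, (s e ∈ W' ∧ t e ∉ W' → s e ∈ W ∧ t e ∉ W) ∧
      (s e ∉ W' ∧ t e ∈ W' → s e ∉ W ∧ t e ∈ W) := by
  obtain ⟨A, hAW, haA, hAc, hA⟩ := exists_component s t ha
  have hbA : b ∈ Aᶜ := mem_compl.2 fun h => hb (hAW h)
  obtain ⟨B, hBA, hbB, hBc, hB⟩ := exists_component s t hbA
  have hAB : ∀ v ∈ A, v ∈ Bᶜ := fun v hv => mem_compl.2 fun h => mem_compl.1 (hBA h) hv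
  obtain ⟨R, hRB, haR, hRc, hR⟩ := exists_component s t (hAB a haA)
  have hAR : ∀ v ∈ A, v ∈ R := by
    intro v hv
    by_contra hvR
    obtain ⟨e, he, h⟩ := (hAc.2 a haA v hv).exists_crossing haR hvR
    simp only [inEdges, mem_filter] at he
    have := hR e (hAB _ he.2.1) (hAB _ he.2.2)
    tauto
  have hRB' : R = Bᶜ := by
    refine hRB.antisymm fun v hv => ?_
    by_contra hvR
    obtain ⟨e, -, h⟩ := hconn.exists_crossing (X := R ∪ B) (mem_union_left _ haR)
      (b := v) (by simpa [hvR] using hv)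
    have h1 := hR e
    have h2 := hB e
    have h3 := hAR (s e)
    have h4 := hAR (t e)
    have h5 := @hBA (s e)
    have h6 := @hBA (t e)
    simp only [mem_union, mem_compl] at h h1 h2 h5 h6
    clear hR hB hAR hBA hRc hBc hAc hA hconn
    grind
  refine ⟨Bᶜ, ⟨hRB' ▸ hRc, by rwa [compl_compl]⟩, fun e => ?_⟩
  have h1 := hA e
  have h2 := hB e
  have h3 := @hAW (s e)
  have h4 := @hAW (t e)
  have h5 := @hBA (s e)
  have h6 := @hBA (t e)
  simp only [mem_compl] at h2 h5 h6 ⊢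
  clear hR hB hAR hBA hRc hBc hAc hA hconn
  grind

lemma ConnOn.card_le {F : Finset E} (h : ConnOn s t F univ) : Fintype.card V ≤ F.card + 1 := by
  have key : ∀ n, n + 1 ≤ Fintype.card V → ∃ (X : Finset V) (F' : Finset E), F' ⊆ F ∧
      X.card = n + 1 ∧ F'.card = n ∧ ∀ e ∈ F', s e ∈ X ∧ t e ∈ X := by
    intro n
    induction n with
    | zero =>
      obtain ⟨a, -⟩ := h.1
      exact fun _ => ⟨{a}, ∅, by simp⟩
    | succ n ih =>
      intro hn
      obtain ⟨X, F', hF, hX, hF', hXF⟩ := ih (by omega)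
      obtain ⟨a, ha⟩ : X.Nonempty := card_pos.1 (by omega)
      obtain ⟨b, hb⟩ : ∃ b, b ∉ X := by
        by_contra! hall
        have : X = univ := eq_univ_iff_forall.2 hall
        rw [this, card_univ] at hX
        omega
      obtain ⟨e, he, hc⟩ := h.exists_crossing ha hb
      have heF : e ∉ F' := fun h => by have := hXF e h; tauto
      rcases hc with hc | hc
      · exact ⟨insert (t e) X, insert e F', insert_subset he hF, by simp [hc, hX],
          by simp [heF, hF'], by grind⟩
      · exact ⟨insert (s e) X, insert e F', insert_subset he hF, by simp [hc, hX],
          by simp [heF, hF'], by grind⟩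
  obtain ⟨a, -⟩ := h.1
  have hpos : 0 < Fintype.card V := Fintype.card_pos_iff.2 ⟨a⟩
  obtain ⟨X, F', hF, -, hF', -⟩ := key (Fintype.card V - 1) (by omega)
  have := card_le_card hF
  omega

lemma source_mem_treeSide (T : Finset E) (e : E) : s e ∈ treeSide s t T e := by
  simp only [treeSide, mem_filter, mem_univ, true_and]
  exact Relation.ReflTransGen.refl

lemma target_notMem_treeSide {T : Finset E} (hT : IsSpanningTree s t T) {e : E} (he : e ∈ T) :
    t e ∉ treeSide s t T e := by
  intro hmem
  have hr : Reach s t (T.erase e) (s e) (t e) := by simpa [treeSide] using hmem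
  have hc : ConnOn s t (T.erase e) univ := by
    refine ⟨hT.1.1, fun a ha b hb => ?_⟩
    have := hT.1.2 a ha b hb
    induction this with
    | refl => exact Relation.ReflTransGen.refl
    | tail _ hbc ih =>
      refine (ih (mem_univ _)).trans ?_
      obtain ⟨f, hf, h⟩ := hbc
      by_cases hfe : f = e
      · subst hfe
        rcases h with ⟨rfl, rfl⟩ | ⟨rfl, rfl⟩
        exacts [hr, hr.symm]
      · exact Relation.ReflTransGen.single ⟨f, mem_erase.2 ⟨hfe, hf⟩, h⟩
  have h1 := hc.card_le
  have h2 := hT.2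
  have h3 := card_erase_of_mem he
  have h4 := card_pos.2 ⟨e, he⟩
  omega

lemma treeSide_congr {T : Finset E} {e f : E} (hf : f ∈ T) (hfe : f ≠ e) :
    s f ∈ treeSide s t T e ↔ t f ∈ treeSide s t T e := by
  have hr : Reach s t (T.erase e) (s f) (t f) := Reach.of_mem (mem_erase.2 ⟨hfe, hf⟩)
  simp only [treeSide, mem_filter, mem_univ, true_and]
  exact ⟨fun h => h.trans hr, fun h => h.trans hr.symm⟩

end Connectivity

section Orientations

variable {V E : Type*} [Fintype V] [Fintype E] [DecidableEq V] [DecidableEq E]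
variable {s t : E → V}

/-- The indegree of `v` in the orientation `o`. -/
def indeg (s t : E → V) (o : E → Bool) (v : V) : ℤ :=
  ((univ.filter fun e => ohead s t o e = v).card : ℤ)

lemma sum_indeg_mul {R : Type*} [CommRing R] (s t : E → V) (o : E → Bool) (r : V → R) :
    ∑ v, (indeg s t o v : R) * r v = ∑ e, r (ohead s t o e) := by
  rw [← Finset.sum_fiberwise univ (ohead s t o)]
  refine sum_congr rfl fun v _ => ?_
  rw [sum_congr rfl (g := fun _ => r v) fun e he => by rw [(mem_filter.1 he).2]]
  simp [indeg]

lemma sum_indeg (s t : E → V) (o : E → Bool) : ∑ v, indeg s t o v = Fintype.card E := by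
  simpa using sum_indeg_mul (R := ℤ) s t o fun _ => 1

lemma sum_lap_mul (s t : E → V) (f r : V → ℤ) :
    ∑ v, lap s t f v * r v = ∑ e, (r (s e) - r (t e)) * (f (s e) - f (t e)) := by
  simp only [lap, sum_mul]
  rw [sum_comm]
  refine sum_congr rfl fun e _ => ?_
  have : ∀ v, ((if s e = v then 1 else 0) - (if t e = v then 1 else 0)) * (f (s e) - f (t e)) * r v
      = (if s e = v then (f (s e) - f (t e)) * r v else 0) -
        (if t e = v then (f (s e) - f (t e)) * r v else 0) := by
    intro v
    split_ifs <;> ring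
  simp only [this, sum_sub_distrib, sum_ite_eq, mem_univ, if_true]
  ring

lemma sum_lap (s t : E → V) (f : V → ℤ) : ∑ v, lap s t f v = 0 := by
  simpa using sum_lap_mul s t f fun _ => 1

lemma lap_add (s t : E → V) (f g : V → ℤ) (v : V) :
    lap s t (fun u => f u + g u) v = lap s t f v + lap s t g v := by
  simp only [lap, ← sum_add_distrib]
  exact sum_congr rfl fun e _ => by ring

lemma lap_mul (s t : E → V) (c : ℤ) (f : V → ℤ) (v : V) :
    lap s t (fun u => c * f u) v = c * lap s t f v := by
  simp only [lap, mul_sum]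
  exact sum_congr rfl fun e _ => by ring

lemma LinEquiv.symm {D D' : V → ℤ} (h : LinEquiv s t D D') : LinEquiv s t D' D := by
  obtain ⟨f, hf⟩ := h
  refine ⟨fun u => -1 * f u, fun v => ?_⟩
  rw [lap_mul, ← hf v]
  ring

lemma LinEquiv.trans {D D' D'' : V → ℤ} (h : LinEquiv s t D D') (h' : LinEquiv s t D' D'') :
    LinEquiv s t D D'' := by
  obtain ⟨f, hf⟩ := h
  obtain ⟨g, hg⟩ := h'
  refine ⟨fun u => f u + g u, fun v => ?_⟩
  rw [lap_add, ← hf v, ← hg v]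
  ring

lemma LinEquiv.sum_eq {D D' : V → ℤ} (h : LinEquiv s t D D') : ∑ v, D v = ∑ v, D' v := by
  obtain ⟨f, hf⟩ := h
  have := sum_lap s t f
  simp only [← hf, sum_sub_distrib] at this
  linarith

/-- Every directed cocycle of the orientation `o` is directed according to `σ`. -/
def CocycleCompatible (s t : E → V) (σ : Finset V → Bool) (o : E → Bool) : Prop :=
  ∀ W : Finset V, Biconn s t W → ∀ b : Bool,
    (∀ e ∈ cutEdges s t W, (ohead s t o e ∈ W ↔ b = true)) → σ W = b

lemma Triangulating.cocycleCompatible {σ : Finset V → Bool} (htri : Triangulating s t σ)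
    {T : Finset E} (hT : IsSpanningTree s t T) {o : E → Bool}
    (ho : ∀ e ∈ T, o e = sigmaOrient s t σ T e) : CocycleCompatible s t σ o := by
  intro W hW b hb
  refine htri T hT W hW b fun e he => ?_
  rw [mem_inter] at he
  rw [← hb e he.1, ohead, ohead, ho e he.2]

/-- Linearly equivalent indegree divisors of compatible orientations coincide. -/
lemma lap_eq_zero_of_compatible (hconn : ConnOn s t univ univ) {σ : Finset V → Bool}
    {o o' : E → Bool} (ho : CocycleCompatible s t σ o) (ho' : CocycleCompatible s t σ o')
    {f : V → ℤ} (hf : ∀ v, indeg s t o v - indeg s t o' v = lap s t f v) (v : V) :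
    lap s t f v = 0 := by
  obtain ⟨a, -, ha⟩ := exists_max_image univ f ⟨v, mem_univ v⟩
  by_cases hconst : ∀ b, f b = f a
  · simp [lap, hconst]
  exfalso
  push Not at hconst
  obtain ⟨b, hb⟩ := hconst
  set r : V → ℤ := fun u => if f u = f a then 1 else 0 with hr
  have hlt : ∀ u, f u ≠ f a → f u + 1 ≤ f a := fun u hu => by
    have := ha u (mem_univ u)
    omega
  have hle : ∀ e ∈ (univ : Finset E), r (ohead s t o e) - r (ohead s t o' e) ≤
      (r (s e) - r (t e)) * (f (s e) - f (t e)) := by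
    intro e _
    have h1 := hlt (s e)
    have h2 := hlt (t e)
    simp only [hr, ohead]
    by_cases h3 : f (s e) = f a <;> by_cases h4 : f (t e) = f a <;>
      cases o e <;> cases o' e <;> simp [h3, h4] <;> grind
  have hsum : ∑ e, (r (ohead s t o e) - r (ohead s t o' e)) =
      ∑ e, (r (s e) - r (t e)) * (f (s e) - f (t e)) := by
    rw [← sum_lap_mul, sum_sub_distrib, ← sum_indeg_mul, ← sum_indeg_mul, ← sum_sub_distrib]
    exact sum_congr rfl fun v _ => by rw [← hf v]; push_cast; ring
  have heq := (sum_eq_sum_iff_of_le hle).1 hsum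
  obtain ⟨W, hW, hcut⟩ := exists_biconn hconn (W := univ.filter fun u => f u = f a) (a := a)
    (b := b) (by simp) (by simpa using hb)
  have hdir : ∀ e ∈ cutEdges s t W, ohead s t o e ∈ W ∧ ohead s t o' e ∉ W := by
    intro e he
    have h0 := heq e (mem_univ e)
    have h1 := hlt (s e)
    have h2 := hlt (t e)
    have h5 := hcut e
    simp only [cutEdges, mem_filter, mem_univ, true_and] at he h5
    simp only [hr, ohead] at h0 ⊢
    by_cases h3 : f (s e) = f a <;> by_cases h4 : f (t e) = f a <;>
      cases hoe : o e <;> cases hoe' : o' e <;> simp [h3, h4, hoe, hoe'] at h0 h5 he ⊢ <;> grind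
  have h1 := ho W hW true fun e he => by simp [(hdir e he).1]
  have h2 := ho' W hW false fun e he => by simp [(hdir e he).2]
  rw [h1] at h2
  exact Bool.noConfusion h2

end Orientations

section Potentials

variable {V E : Type*} [Fintype V] [Fintype E] [DecidableEq V] [DecidableEq E]
variable {s t : E → V}

/-- The potential on the vertices whose increments along the edges of the tree `T` are the
weights `x`. -/
noncomputable def treePotential (s t : E → V) (x : E → ℝ) (T : Finset E) (v : V) : ℝ :=
  ∑ f ∈ T, if v ∈ treeSide s t T f then 0 else x f

/-- The weight of `e` reduced by the tree potential, i.e. the total weight of the fundamental cycle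
of `e`. -/
noncomputable def reducedWeight (s t : E → V) (x : E → ℝ) (T : Finset E) (e : E) : ℝ :=
  x e - (treePotential s t x T (t e) - treePotential s t x T (s e))

lemma reducedWeight_of_mem {x : E → ℝ} {T : Finset E} (hT : IsSpanningTree s t T) {e : E}
    (he : e ∈ T) : reducedWeight s t x T e = 0 := by
  rw [reducedWeight, treePotential, treePotential, ← sum_sub_distrib, sum_eq_single_of_mem e he]
  · simp [source_mem_treeSide, target_notMem_treeSide hT he]
  · intro f _ hfe
    simp [treeSide_congr (s := s) (t := t) he hfe.symm]

lemma reducedWeight_ne_zero {x : E → ℝ} (hx : LinearIndependent ℚ x) {T : Finset E} {e : E}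
    (he : e ∉ T) : reducedWeight s t x T e ≠ 0 := by
  intro h
  refine hx.notMem_span_image (s := (T : Set E)) (x := e) (by simpa using he) ?_
  have : x e = ∑ f ∈ T, ((if t e ∈ treeSide s t T f then 0 else x f) -
      (if s e ∈ treeSide s t T f then 0 else x f)) := by
    rw [sum_sub_distrib]
    simp only [reducedWeight, treePotential] at h
    linarith
  rw [this]
  refine Submodule.sum_mem _ fun f hf => Submodule.sub_mem _ ?_ ?_ <;>
  · split_ifs
    · exact Submodule.zero_mem _
    · exact Submodule.subset_span ⟨f, by simpa using hf, rfl⟩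

/-- The orientation which is given by `σ` on the edges of `T`, and directs the fundamental cycle
of an edge outside `T` so that its total weight is positive. -/
noncomputable def treeOrient (s t : E → V) (σ : Finset V → Bool) (x : E → ℝ) (T : Finset E) :
    E → Bool :=
  fun e => if e ∈ T then sigmaOrient s t σ T e else decide (0 < reducedWeight s t x T e)

lemma sum_reducedWeight_ohead (s t : E → V) (x : E → ℝ) (T : Finset E) {o o' : E → Bool}
    (h : indeg s t o = indeg s t o') :
    ∑ e, reducedWeight s t x T e * ((if o e then 1 else 0) - (if o' e then 1 else 0)) =
      ∑ e, x e * ((if o e then 1 else 0) - (if o' e then 1 else 0)) := by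
  set p := treePotential s t x T with hp
  have h1 : ∑ e, (p (ohead s t o e) - p (ohead s t o' e)) = 0 := by
    rw [sum_sub_distrib, ← sum_indeg_mul, ← sum_indeg_mul, h, sub_self]
  refine (sub_eq_zero.1 (Eq.trans ?_ h1)).symm
  rw [← sum_sub_distrib]
  refine sum_congr rfl fun e _ => ?_
  simp only [reducedWeight, ← hp, ohead]
  cases o e <;> cases o' e <;> (simp; try ring)

lemma treeOrient_mul_nonneg (σ : Finset V → Bool) (x : E → ℝ) {T : Finset E}
    (hT : IsSpanningTree s t T) (o : E → Bool) (e : E) :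
    0 ≤ reducedWeight s t x T e *
      ((if treeOrient s t σ x T e then 1 else 0) - (if o e then 1 else 0)) := by
  by_cases he : e ∈ T
  · rw [reducedWeight_of_mem hT he, zero_mul]
  · simp only [treeOrient, he, if_false, decide_eq_true_eq]
    rcases lt_or_ge 0 (reducedWeight s t x T e) with h | h
    · cases o e <;> simp [h, h.le]
    · cases o e <;> simp [h.not_gt, h]

lemma treeOrient_eq {σ : Finset V → Bool} {x : E → ℝ} (hx : LinearIndependent ℚ x)
    {T T' : Finset E} (hT : IsSpanningTree s t T) (hT' : IsSpanningTree s t T')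
    (h : indeg s t (treeOrient s t σ x T) = indeg s t (treeOrient s t σ x T'))
    {e : E} (he : e ∉ T) : treeOrient s t σ x T e = treeOrient s t σ x T' e := by
  have h1 := sum_reducedWeight_ohead s t x T h
  have h2 := sum_reducedWeight_ohead s t x T' h.symm
  have hnn := fun e => treeOrient_mul_nonneg σ x hT (treeOrient s t σ x T') e
  have hnn' := fun e => treeOrient_mul_nonneg σ x hT' (treeOrient s t σ x T) e
  have h3 := sum_nonneg fun e (_ : e ∈ (univ : Finset E)) => hnn e
  have h4 := sum_nonneg fun e (_ : e ∈ (univ : Finset E)) => hnn' e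
  have h5 : ∑ e, x e * ((if treeOrient s t σ x T e then 1 else 0) -
      (if treeOrient s t σ x T' e then 1 else 0)) = -∑ e, x e *
      ((if treeOrient s t σ x T' e then 1 else 0) - (if treeOrient s t σ x T e then 1 else 0)) := by
    rw [← sum_neg_distrib]
    exact sum_congr rfl fun e _ => by ring
  have h6 := (sum_eq_zero_iff_of_nonneg fun e _ => hnn e).1 (by linarith) e (mem_univ e)
  have h7 := (mul_eq_zero.1 h6).resolve_left (reducedWeight_ne_zero hx he)
  revert h7
  cases treeOrient s t σ x T e <;> cases treeOrient s t σ x T' e <;> simp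

/-- A spanning tree is determined by the indegrees of its orientation `treeOrient`. -/
lemma treeOrient_injective (hconn : ConnOn s t univ univ) {σ : Finset V → Bool}
    (htri : Triangulating s t σ) {x : E → ℝ} (hx : LinearIndependent ℚ x)
    {T T' : Finset E} (hT : IsSpanningTree s t T) (hT' : IsSpanningTree s t T')
    (h : indeg s t (treeOrient s t σ x T) = indeg s t (treeOrient s t σ x T')) : T = T' := by
  by_contra hne
  obtain ⟨e₀, he₀, he₀'⟩ : ∃ e ∈ T, e ∉ T' := by
    by_contra! hsub
    exact hne (eq_of_subset_of_card_le hsub (by have := hT.2; have := hT'.2; omega))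
  set r : V → ℝ := fun v => treePotential s t x T' v - treePotential s t x T v with hr
  have hδ : ∀ e, r (t e) - r (s e) = reducedWeight s t x T e - reducedWeight s t x T' e := by
    intro e
    simp only [hr, reducedWeight]
    ring
  obtain ⟨a, -, ha⟩ := exists_max_image univ r ⟨s e₀, mem_univ _⟩
  obtain ⟨b, hb⟩ : ∃ b, r b ≠ r a := by
    by_contra! hconst
    refine reducedWeight_ne_zero (s := s) (t := t) hx he₀' ?_
    have := hδ e₀
    rw [hconst (t e₀), hconst (s e₀), reducedWeight_of_mem hT he₀] at this
    linarith
  have hlt : ∀ u, r u ≠ r a → r u < r a := fun u hu => lt_of_le_of_ne (ha u (mem_univ u)) hu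
  obtain ⟨W, hW, hcut⟩ := exists_biconn hconn (W := univ.filter fun u => r u = r a) (a := a)
    (b := b) (by simp) (by simpa using hb)
  have hcut' : ∀ e ∈ cutEdges s t W, (s e ∈ W ∧ t e ∉ W ∧ r (t e) - r (s e) < 0) ∨
      (s e ∉ W ∧ t e ∈ W ∧ 0 < r (t e) - r (s e)) := by
    intro e he
    have h1 := hcut e
    have h2 := hlt (s e)
    have h3 := hlt (t e)
    simp only [cutEdges, mem_filter, mem_univ, true_and] at he h1
    rcases he with he | he
    · have h4 := h1.1 he
      exact Or.inl ⟨he.1, he.2, by rw [h4.1]; linarith [h3 h4.2]⟩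
    · have h4 := h1.2 he
      exact Or.inr ⟨he.1, he.2, by rw [h4.2]; linarith [h2 h4.1]⟩
  have hfalse : σ W = false := by
    refine htri T hT W hW false fun e he => ?_
    obtain ⟨hec, heT⟩ := mem_inter.1 he
    have hc := hcut' e hec
    rw [hδ e, reducedWeight_of_mem hT heT] at hc
    have heT' : e ∉ T' := fun h' => by
      rw [reducedWeight_of_mem hT' h'] at hc
      simp at hc
    have h1 := treeOrient_eq hx hT' hT h.symm heT'
    simp only [treeOrient, heT, heT', if_true, if_false] at h1
    simp only [ohead, ← h1]
    rcases hc with ⟨h2, h3, h4⟩ | ⟨h2, h3, h4⟩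
    · have h5 : 0 < reducedWeight s t x T' e := by linarith
      simp [h5, h3]
    · have h5 : ¬ 0 < reducedWeight s t x T' e := by linarith
      simp [h5, h2]
  have htrue : σ W = true := by
    refine htri T' hT' W hW true fun e he => ?_
    obtain ⟨hec, heT'⟩ := mem_inter.1 he
    have hc := hcut' e hec
    rw [hδ e, reducedWeight_of_mem hT' heT'] at hc
    have heT : e ∉ T := fun h' => by
      rw [reducedWeight_of_mem hT h'] at hc
      simp at hc
    have h1 := treeOrient_eq hx hT hT' h heT
    simp only [treeOrient, heT, heT', if_true, if_false] at h1
    simp only [ohead, ← h1]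
    rcases hc with ⟨h2, h3, h4⟩ | ⟨h2, h3, h4⟩
    · have h5 : ¬ 0 < reducedWeight s t x T e := by linarith
      simp [h5, h2]
    · have h5 : 0 < reducedWeight s t x T e := by linarith
      simp [h5, h3]
  rw [htrue] at hfalse
  exact Bool.noConfusion hfalse

lemma exists_linearIndependent_real (E : Type*) [Finite E] :
    ∃ x : E → ℝ, LinearIndependent ℚ x := by
  let B := Module.Basis.ofVectorSpace ℚ ℝ
  have : Infinite (Module.Basis.ofVectorSpaceIndex ℚ ℝ) := by
    by_contra hfin
    rw [not_infinite_iff_finite] at hfin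
    have := Module.Finite.of_basis B
    have h := Module.rank_lt_aleph0 ℚ ℝ
    rw [Real.rank_rat_real] at h
    exact absurd h Cardinal.aleph0_lt_continuum.not_gt
  obtain ⟨n, ⟨φ⟩⟩ := Finite.exists_equiv_fin E
  exact ⟨_, B.linearIndependent.comp _
    ((Infinite.natEmbedding _).injective.comp (Fin.val_injective.comp φ.injective))⟩

end Potentials

section ReducedDivisors

variable {V E : Type*} [Fintype V] [Fintype E] [DecidableEq V] [DecidableEq E]
variable {s t : E → V}

/-- The edges of `F` with one endpoint at `v` and the other endpoint in `X`. -/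
def edgesTo (s t : E → V) (F : Finset E) (X : Finset V) (v : V) : Finset E :=
  F.filter fun e => (s e = v ∧ t e ∈ X) ∨ (t e = v ∧ s e ∈ X)

/-- The divisor `D` is nonnegative away from `q`, and no set of vertices avoiding `q` can fire. -/
def IsQReduced (s t : E → V) (q : V) (D : V → ℤ) : Prop :=
  (∀ v, v ≠ q → 0 ≤ D v) ∧ ∀ W : Finset V, q ∉ W → W.Nonempty →
    ∃ v ∈ W, D v < (edgesTo s t univ Wᶜ v).card

lemma lap_indicator_of_mem {W : Finset V} {v : V} (hv : v ∈ W) :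
    lap s t (fun u => if u ∈ W then 1 else 0) v = (edgesTo s t univ Wᶜ v).card := by
  simp only [lap, edgesTo, card_filter, mem_compl]
  push_cast
  refine sum_congr rfl fun e _ => ?_
  by_cases h1 : s e = v <;> by_cases h2 : t e = v
  · simp [h1, h2, hv]
  · subst h1
    by_cases h3 : t e ∈ W <;> simp [h2, h3, hv]
  · subst h2
    by_cases h3 : s e ∈ W <;> simp [h1, h3, hv]
  · simp [h1, h2]

lemma lap_indicator_of_notMem {W : Finset V} {v : V} (hv : v ∉ W) :
    lap s t (fun u => if u ∈ W then 1 else 0) v = -(edgesTo s t univ W v).card := by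
  simp only [lap, edgesTo, card_filter]
  push_cast
  rw [← sum_neg_distrib]
  refine sum_congr rfl fun e _ => ?_
  by_cases h1 : s e = v <;> by_cases h2 : t e = v
  · simp [h1, h2, hv]
  · subst h1
    by_cases h3 : t e ∈ W <;> simp [h2, h3, hv]
  · subst h2
    by_cases h3 : s e ∈ W <;> simp [h1, h3, hv]
  · simp [h1, h2]

lemma lap_nonneg_of_forall_le {h : V → ℤ} {v : V} (hv : ∀ w, h w ≤ h v) : 0 ≤ lap s t h v := by
  refine sum_nonneg fun e _ => ?_
  have h1 := hv (s e)
  have h2 := hv (t e)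
  split_ifs with h3 h4 h4
  · simp
  · subst h3
    linarith
  · subst h4
    linarith
  · simp

lemma exists_lap_pos (hconn : ConnOn s t univ univ) (q : V) :
    ∃ h : V → ℤ, h q = 0 ∧ (∀ v, 0 ≤ h v) ∧ ∀ v, v ≠ q → 0 < lap s t h v := by
  have key : ∀ n, n + 1 ≤ Fintype.card V → ∃ (X : Finset V) (h : V → ℤ), q ∈ X ∧
      n + 1 ≤ X.card ∧ h q = 0 ∧ (∀ v, 0 ≤ h v) ∧ (∀ v ∉ X, ∀ w, h w ≤ h v) ∧
      ∀ v ∈ X, v ≠ q → 0 < lap s t h v := by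
    intro n
    induction n with
    | zero => exact fun _ => ⟨{q}, fun _ => 0, by simp⟩
    | succ n ih =>
      intro hn
      obtain ⟨X, h, hqX, hX, hq, hnn, hmax, hpos⟩ := ih (by omega)
      by_cases hXn : n + 2 ≤ X.card
      · exact ⟨X, h, hqX, hXn, hq, hnn, hmax, hpos⟩
      obtain ⟨b, hb⟩ : ∃ b, b ∉ X := by
        by_contra! hall
        have : X = univ := eq_univ_iff_forall.2 hall
        rw [this, card_univ] at hXn
        omega
      obtain ⟨e, -, hc⟩ := hconn.exists_crossing hqX hb
      obtain ⟨u, hu, hue⟩ : ∃ u, u ∉ X ∧ e ∈ edgesTo s t univ X u := by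
        rcases hc with hc | hc
        · exact ⟨t e, hc.2, by simp [edgesTo, hc]⟩
        · exact ⟨s e, hc.1, by simp [edgesTo, hc]⟩
      set k : ℤ := Fintype.card E + 1 with hk
      have hlap : ∀ v, lap s t (fun u => k * h u + if u ∈ Xᶜ then 1 else 0) v =
          k * lap s t h v + lap s t (fun u => if u ∈ Xᶜ then 1 else 0) v := fun v => by
        rw [lap_add, lap_mul]
      refine ⟨insert u X, fun v => k * h v + if v ∈ Xᶜ then 1 else 0, mem_insert_of_mem hqX,
        by rw [card_insert_of_notMem hu]; omega, by simp [hq, hqX], fun v => ?_,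
        fun v hv w => ?_, fun v hv hvq => ?_⟩
      · have := hnn v
        positivity
      · rw [mem_insert, not_or] at hv
        have h1 := mul_le_mul_of_nonneg_left (hmax v hv.2 w) (show 0 ≤ k by positivity)
        have h2 : v ∈ Xᶜ := mem_compl.2 hv.2
        simp only [h2, if_true]
        split_ifs <;> linarith
      · rw [hlap]
        rcases mem_insert.1 hv with rfl | hvX
        · rw [lap_indicator_of_mem (mem_compl.2 hu), compl_compl]
          have h1 : 0 < ((edgesTo s t univ X v).card : ℤ) := by
            exact_mod_cast card_pos.2 ⟨e, hue⟩
          have h2 := lap_nonneg_of_forall_le (s := s) (t := t) (hmax v hu)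
          positivity
        · rw [lap_indicator_of_notMem (by simpa using hvX)]
          have h1 : ((edgesTo s t univ Xᶜ v).card : ℤ) ≤ Fintype.card E := by
            exact_mod_cast card_le_univ _
          have h2 : k * 1 ≤ k * lap s t h v :=
            mul_le_mul_of_nonneg_left (hpos v hvX hvq) (by positivity)
          linarith
  have hcard : 0 < Fintype.card V := Fintype.card_pos_iff.2 ⟨q⟩
  obtain ⟨X, h, -, hX, hq, hnn, -, hpos⟩ := key (Fintype.card V - 1) (by omega)
  have hXu : X = univ := (card_eq_iff_eq_univ X).1 (by have := card_le_univ X; omega)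
  exact ⟨h, hq, hnn, fun v hv => hpos v (hXu ▸ mem_univ v) hv⟩

lemma exists_isQReduced (hconn : ConnOn s t univ univ) (q : V) (D : V → ℤ) :
    ∃ D', LinEquiv s t D D' ∧ IsQReduced s t q D' := by
  obtain ⟨h, hq, hnn, hpos⟩ := exists_lap_pos hconn q
  set P : ℕ → Prop := fun n => ∃ D', LinEquiv s t D D' ∧ (∀ v, v ≠ q → 0 ≤ D' v) ∧
    (∑ v, D' v * h v).toNat = n with hP
  have hex : ∃ n, P n := by
    set k : ℤ := ∑ v, |D v| with hk
    refine ⟨_, fun v => D v + k * lap s t h v, ⟨fun u => -k * h u, fun v => ?_⟩, fun v hv => ?_,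
      rfl⟩
    · rw [lap_mul]
      ring
    · have h1 : |D v| ≤ k := single_le_sum (f := fun v => |D v|) (fun v _ => abs_nonneg _)
        (mem_univ v)
      have h2 := neg_abs_le (D v)
      have h3 : k * 1 ≤ k * lap s t h v :=
        mul_le_mul_of_nonneg_left (hpos v hv) (le_trans (abs_nonneg _) h1)
      linarith
  obtain ⟨D', hDD', hD', hn⟩ := Nat.find_spec hex
  refine ⟨D', hDD', hD', fun W hqW hW => ?_⟩
  by_contra! hfire
  set f : V → ℤ := fun u => if u ∈ W then 1 else 0 with hf
  have hE : LinEquiv s t D' (fun v => D' v - lap s t f v) := ⟨f, fun v => by ring⟩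
  have hterm : ∀ v, 0 ≤ D' v * h v := fun v => by
    by_cases hv : v = q
    · simp [hv, hq]
    · exact mul_nonneg (hD' v hv) (hnn v)
  have hadj : ∑ v, lap s t f v * h v = ∑ v ∈ W, lap s t h v := by
    have : ∑ v ∈ W, lap s t h v = ∑ v, lap s t h v * f v := by
      simp [hf, sum_ite_mem]
    rw [this, sum_lap_mul, sum_lap_mul]
    exact sum_congr rfl fun e _ => by ring
  have hdec : 0 < ∑ v ∈ W, lap s t h v :=
    sum_pos (fun v hv => hpos v fun hvq => hqW (hvq ▸ hv)) hW
  have hnew : ∀ v, v ≠ q → 0 ≤ D' v - lap s t f v := fun v hv => by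
    by_cases hvW : v ∈ W
    · rw [hf, lap_indicator_of_mem hvW]
      linarith [hfire v hvW]
    · rw [hf, lap_indicator_of_notMem hvW]
      have := hD' v hv
      linarith [Int.natCast_nonneg (edgesTo s t univ W v).card]
  have hsum : ∑ v, (D' v - lap s t f v) * h v = ∑ v, D' v * h v - ∑ v ∈ W, lap s t h v := by
    rw [← hadj, ← sum_sub_distrib]
    exact sum_congr rfl fun v _ => by ring
  have hnonneg : 0 ≤ ∑ v, (D' v - lap s t f v) * h v := sum_nonneg fun v _ => by
    by_cases hv : v = q
    · simp [hv, hq]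
    · exact mul_nonneg (hnew v hv) (hnn v)
  refine Nat.find_min hex (m := (∑ v, (D' v - lap s t f v) * h v).toNat) ?_
    ⟨_, hDD'.trans hE, hnew, rfl⟩
  rw [← hn]
  omega

/-- The burning process gets stuck only when all vertices are burned. -/
lemma eq_univ_of_no_crossing {q : V} {X : Finset V} {P : Finset E} (hq : q ∈ X)
    (hstuck : ∀ e ∉ P, (s e ∈ X ↔ t e ∈ X)) {D : V → ℤ} (hD : IsQReduced s t q D)
    (hP : ∀ v ∉ X, ((edgesTo s t P univ v).card : ℤ) ≤ D v) : X = univ := by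
  by_contra hX
  obtain ⟨v, hv, hlt⟩ := hD.2 Xᶜ (by simpa using hq)
    (nonempty_iff_ne_empty.2 fun h => hX ((compl_eq_empty_iff X).1 h))
  rw [mem_compl] at hv
  rw [compl_compl] at hlt
  have hsub : edgesTo s t univ X v ⊆ edgesTo s t P univ v := by
    intro e he
    simp only [edgesTo, mem_filter, mem_univ, true_and, and_true] at he ⊢
    have := hstuck e
    rcases he with ⟨rfl, he⟩ | ⟨rfl, he⟩ <;> grind
  have h1 : ((edgesTo s t univ X v).card : ℤ) ≤ (edgesTo s t P univ v).card := by
    exact_mod_cast card_le_card hsub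
  linarith [hP v hv]

/-- Dhar's burning algorithm: having burned the vertices `X` and explored the edges `P`, it attaches
to every reduced divisor a forest of unexplored edges along which the fire spreads from `X` to the
remaining vertices, and the forest determines the divisor on these vertices. -/
lemma exists_burning (s t : E → V) (q : V) (n : ℕ) :
    ∀ (X : Finset V) (P : Finset E), q ∈ X → Pᶜ.card = n →
    ∃ Ψ : (V → ℤ) → Finset E,
      (∀ D, IsQReduced s t q D → (∀ v ∉ X, ((edgesTo s t P univ v).card : ℤ) ≤ D v) →
        Disjoint (Ψ D) P ∧ (Ψ D).card = Xᶜ.card ∧ ∀ v, ∃ x ∈ X, Reach s t (Ψ D) x v) ∧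
      ∀ D D', IsQReduced s t q D → (∀ v ∉ X, ((edgesTo s t P univ v).card : ℤ) ≤ D v) →
        IsQReduced s t q D' → (∀ v ∉ X, ((edgesTo s t P univ v).card : ℤ) ≤ D' v) →
        Ψ D = Ψ D' → ∀ v ∉ X, D v = D' v := by
  induction n with
  | zero =>
    intro X P hq hn
    have hP : P = univ := by simpa using hn
    have hstuck : ∀ e ∉ P, (s e ∈ X ↔ t e ∈ X) := by simp [hP]
    refine ⟨fun _ => ∅, fun D hD hDP => ?_, fun D D' hD hDP _ _ _ v hv => ?_⟩
    · have hX := eq_univ_of_no_crossing hq hstuck hD hDP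
      exact ⟨disjoint_empty_left _, by simp [hX], fun v =>
        ⟨v, hX ▸ mem_univ v, Relation.ReflTransGen.refl⟩⟩
    · exact absurd (eq_univ_of_no_crossing hq hstuck hD hDP ▸ mem_univ v) hv
  | succ n ih =>
    intro X P hq hn
    by_cases hstuck : ∀ e ∉ P, (s e ∈ X ↔ t e ∈ X)
    · refine ⟨fun _ => ∅, fun D hD hDP => ?_, fun D D' hD hDP _ _ _ v hv => ?_⟩
      · have hX := eq_univ_of_no_crossing hq hstuck hD hDP
        exact ⟨disjoint_empty_left _, by simp [hX], fun v =>
          ⟨v, hX ▸ mem_univ v, Relation.ReflTransGen.refl⟩⟩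
      · exact absurd (eq_univ_of_no_crossing hq hstuck hD hDP ▸ mem_univ v) hv
    · push Not at hstuck
      obtain ⟨e, heP, hc⟩ := hstuck
      obtain ⟨u, v, hu, hv, huv⟩ : ∃ u v, u ∈ X ∧ v ∉ X ∧
          ((s e = u ∧ t e = v) ∨ (s e = v ∧ t e = u)) := by
        rcases hc with hc | hc
        · exact ⟨s e, t e, hc.1, hc.2, Or.inl ⟨rfl, rfl⟩⟩
        · exact ⟨t e, s e, hc.2, hc.1, Or.inr ⟨rfl, rfl⟩⟩
      have hn' : (insert e P)ᶜ.card = n := by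
        rw [card_compl, card_insert_of_notMem heP]
        rw [card_compl] at hn
        omega
      have hdeg : ∀ w ∉ insert v X, edgesTo s t (insert e P) univ w = edgesTo s t P univ w := by
        intro w hw
        rw [mem_insert, not_or] at hw
        rw [edgesTo, filter_insert, if_neg, edgesTo]
        grind
      have hdegv : (edgesTo s t (insert e P) univ v).card ≤ (edgesTo s t P univ v).card + 1 := by
        rw [edgesTo, filter_insert]
        split_ifs
        · exact card_insert_le _ _
        · exact Nat.le_succ _
      obtain ⟨Ψ₁, hΨ₁, hinj₁⟩ := ih (insert v X) (insert e P) (mem_insert_of_mem hq) hn'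
      obtain ⟨Ψ₂, hΨ₂, hinj₂⟩ := ih X (insert e P) hq hn'
      have hgood₁ : ∀ D : V → ℤ, (∀ w ∉ X, ((edgesTo s t P univ w).card : ℤ) ≤ D w) →
          ∀ w ∉ insert v X, ((edgesTo s t (insert e P) univ w).card : ℤ) ≤ D w := by
        intro D hD w hw
        rw [hdeg w hw]
        exact hD w fun h => hw (mem_insert_of_mem h)
      have hgood₂ : ∀ D : V → ℤ, (∀ w ∉ X, ((edgesTo s t P univ w).card : ℤ) ≤ D w) →
          D v ≠ (edgesTo s t P univ v).card →
          ∀ w ∉ X, ((edgesTo s t (insert e P) univ w).card : ℤ) ≤ D w := by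
        intro D hD hne w hw
        by_cases hwv : w = v
        · subst hwv
          have := hD w hw
          omega
        · rw [hdeg w (by simp [hwv, hw])]
          exact hD w hw
      refine ⟨fun D => if D v = (edgesTo s t P univ v).card then insert e (Ψ₁ D) else Ψ₂ D,
        fun D hD hDP => ?_, fun D D' hD hDP hD' hDP' heq w hw => ?_⟩
      · by_cases hDv : D v = (edgesTo s t P univ v).card
        · obtain ⟨h1, h2, h3⟩ := hΨ₁ D hD (hgood₁ D hDP)
          rw [disjoint_insert_right] at h1
          simp only [hDv, if_true]
          refine ⟨disjoint_insert_left.2 ⟨heP, h1.2⟩, ?_, fun w => ?_⟩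
          · rw [card_insert_of_notMem h1.1, h2, card_compl, card_compl, card_insert_of_notMem hv]
            have := card_lt_univ_of_notMem hv
            omega
          · obtain ⟨x, hx, hr⟩ := h3 w
            have hr' := hr.mono (subset_insert e _)
            rcases mem_insert.1 hx with rfl | hx
            · exact ⟨u, hu, Relation.ReflTransGen.head ⟨e, mem_insert_self _ _, huv⟩ hr'⟩
            · exact ⟨x, hx, hr'⟩
        · obtain ⟨h1, h2, h3⟩ := hΨ₂ D hD (hgood₂ D hDP hDv)
          rw [disjoint_insert_right] at h1
          simp only [hDv, if_false]
          exact ⟨h1.2, h2, h3⟩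
      · by_cases hDv : D v = (edgesTo s t P univ v).card <;>
          by_cases hDv' : D' v = (edgesTo s t P univ v).card
        · simp only [hDv, hDv', if_true] at heq
          have h1 := (disjoint_insert_right.1 (hΨ₁ D hD (hgood₁ D hDP)).1).1
          have h1' := (disjoint_insert_right.1 (hΨ₁ D' hD' (hgood₁ D' hDP')).1).1
          by_cases hwv : w = v
          · rw [hwv, hDv, hDv']
          · refine hinj₁ D D' hD (hgood₁ D hDP) hD' (hgood₁ D' hDP') ?_ w (by simp [hwv, hw])
            rw [← erase_insert h1, heq, erase_insert h1']
        · simp only [hDv, hDv', if_true, if_false] at heq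
          have h1 := (disjoint_insert_right.1 (hΨ₂ D' hD' (hgood₂ D' hDP' hDv')).1).1
          exact absurd (heq ▸ mem_insert_self _ _) h1
        · simp only [hDv, hDv', if_true, if_false] at heq
          have h1 := (disjoint_insert_right.1 (hΨ₂ D hD (hgood₂ D hDP hDv)).1).1
          exact absurd (heq.symm ▸ mem_insert_self _ _) h1
        · simp only [hDv, hDv', if_false] at heq
          exact hinj₂ D D' hD (hgood₂ D hDP hDv) hD' (hgood₂ D' hDP' hDv') heq w hw

/-- There are at most as many divisor classes of a given degree as spanning trees. -/
lemma exists_tree_of_divisor (hconn : ConnOn s t univ univ) (q : V) :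
    ∃ Ψ : (V → ℤ) → Finset E, (∀ D, IsSpanningTree s t (Ψ D)) ∧
      ∀ D D', ∑ v, D v = ∑ v, D' v → Ψ D = Ψ D' → LinEquiv s t D D' := by
  choose red hequiv hred using exists_isQReduced hconn q
  obtain ⟨Ψ, hΨ, hinj⟩ := exists_burning s t q _ {q} ∅ (mem_singleton_self q) rfl
  have hgood : ∀ D v, v ∉ ({q} : Finset V) →
      ((edgesTo s t ∅ univ v).card : ℤ) ≤ red D v := by
    intro D v hv
    simpa [edgesTo] using (hred D).1 v (by simpa using hv)
  refine ⟨fun D => Ψ (red D), fun D => ?_, fun D D' hdeg heq => ?_⟩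
  · obtain ⟨-, hcard, hr⟩ := hΨ _ (hred D) (hgood D)
    refine ⟨connOn_of_reach (mem_univ q) fun v _ => ?_, ?_⟩
    · simpa using hr v
    · have : 0 < Fintype.card V := Fintype.card_pos_iff.2 ⟨q⟩
      rw [hcard, card_compl, card_singleton]
      omega
  · have h1 : ∀ v, v ≠ q → red D v = red D' v := fun v hv =>
      hinj _ _ (hred D) (hgood D) (hred D') (hgood D') heq v (by simpa using hv)
    have h2 : red D = red D' := by
      funext v
      by_cases hv : v = q
      · rw [(hequiv D).sum_eq, (hequiv D').sum_eq, ← add_sum_erase _ _ (mem_univ q),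
          ← add_sum_erase _ _ (mem_univ q),
          sum_congr rfl fun v hv => h1 v (ne_of_mem_erase hv)] at hdeg
        rw [hv]
        exact add_right_cancel hdeg
      · exact h1 v hv
    exact (hequiv D).trans (h2 ▸ (hequiv D').symm)

end ReducedDivisors

section Statements

variable {V E : Type*} [Fintype V] [Fintype E] [DecidableEq V] [DecidableEq E]

lemma breakDiv_add_IG (s t : E → V) (σ : Finset V → Bool) (q : V) {T : Finset E}
    {o o' : E → Bool} (h : ∀ e ∈ T, o' e = sigmaOrient s t σ T e) (h' : ∀ e ∉ T, o' e = o e)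
    (v : V) :
    breakDiv s t T o v + IG s t σ q T v = indeg s t o' v - 1 + if v = q then 1 else 0 := by
  have hcard : (univ.filter fun e => ohead s t o' e = v).card =
      (univ.filter fun e => e ∉ T ∧ ohead s t o e = v).card +
        (T.filter fun e => ohead s t (sigmaOrient s t σ T) e = v).card := by
    rw [← card_union_of_disjoint]
    · congr 1
      ext e
      simp only [mem_union, mem_filter, mem_univ, true_and]
      by_cases he : e ∈ T
      · simp [he, ohead, h e he]
      · simp [he, ohead, h' e he]
    · rw [disjoint_left]
      intro e he
      simp only [mem_filter] at he ⊢
      tauto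
  simp only [breakDiv, IG, indeg, hcard]
  push_cast
  ring

lemma exists_indeg_of_mem_BDset {s t : E → V} {σ : Finset V → Bool}
    (htri : Triangulating s t σ) {q : V} {D : V → ℤ} (hD : D ∈ BDset s t σ q) :
    ∃ o, CocycleCompatible s t σ o ∧ ∀ v, D v = indeg s t o v - 1 + if v = q then 1 else 0 := by
  obtain ⟨T, o, hT, rfl⟩ := hD
  refine ⟨fun e => if e ∈ T then sigmaOrient s t σ T e else o e,
    htri.cocycleCompatible hT fun e he => by simp [he], fun v => ?_⟩
  exact breakDiv_add_IG s t σ q (fun e he => by simp [he]) (fun e he => by simp [he]) v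

/-- For a triangulating cocycle signature `σ*` and `q ∈ V(G)`, every divisor
of degree `g` is linearly equivalent to exactly one element of `BD_{I_G^{σ*}}(G)`. -/
theorem stmt_7 (s t : E → V) (hloop : ∀ e, s e ≠ t e)
    (hconn : ConnOn s t Finset.univ Finset.univ)
    (q : V) (σ : Finset V → Bool) (hsig : IsSignature s t σ) (htri : Triangulating s t σ) :
    ∀ D : V → ℤ, (∑ v : V, D v) = genus s t →
      ∃! D' : V → ℤ, D' ∈ BDset s t σ q ∧ LinEquiv s t D D' := by
  have huniq : ∀ D₁ ∈ BDset s t σ q, ∀ D₂ ∈ BDset s t σ q, LinEquiv s t D₁ D₂ → D₁ = D₂ := by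
    rintro D₁ h₁ D₂ h₂ ⟨f, hf⟩
    obtain ⟨o₁, ho₁, hD₁⟩ := exists_indeg_of_mem_BDset htri h₁
    obtain ⟨o₂, ho₂, hD₂⟩ := exists_indeg_of_mem_BDset htri h₂
    funext v
    rw [← sub_eq_zero, hf v]
    refine lap_eq_zero_of_compatible hconn ho₁ ho₂ (fun u => ?_) v
    rw [← hf u, hD₁, hD₂]
    ring
  intro D hD
  obtain ⟨x, hx⟩ := exists_linearIndependent_real E
  obtain ⟨Ψ, hΨ, hΨinj⟩ := exists_tree_of_divisor hconn q
  set Φ : Finset E → V → ℤ := fun T v =>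
    indeg s t (treeOrient s t σ x T) v - 1 + if v = q then 1 else 0 with hΦ
  have hΦmem : ∀ T, IsSpanningTree s t T → Φ T ∈ BDset s t σ q := fun T hT =>
    ⟨T, treeOrient s t σ x T, hT, funext fun v => (breakDiv_add_IG s t σ q
      (fun e he => by simp [treeOrient, he]) (fun _ _ => rfl) v).symm⟩
  have hΦdeg : ∀ T, ∑ v, Φ T v = genus s t := fun T => by
    simp only [hΦ, sum_add_distrib, sum_sub_distrib, sum_indeg, genus]
    simp
  have hinj : Function.Injective fun T : {T // IsSpanningTree s t T} =>
      (⟨Ψ (Φ T), hΨ _⟩ : {T // IsSpanningTree s t T}) := by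
    rintro ⟨T, hT⟩ ⟨T', hT'⟩ heq
    rw [Subtype.mk.injEq] at heq ⊢
    have h1 := huniq _ (hΦmem T hT) _ (hΦmem T' hT')
      (hΨinj _ _ ((hΦdeg T).trans (hΦdeg T').symm) heq)
    refine treeOrient_injective hconn htri hx hT hT' (funext fun v => ?_)
    have h2 := congrFun h1 v
    simp only [hΦ] at h2
    linarith
  obtain ⟨⟨T, hT⟩, hTD⟩ := Finite.surjective_of_injective hinj ⟨Ψ D, hΨ D⟩
  rw [Subtype.mk.injEq] at hTD
  have hequiv : LinEquiv s t D (Φ T) := hΨinj _ _ (hD.trans (hΦdeg T).symm) hTD.symm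
  exact ⟨Φ T, ⟨hΦmem T hT, hequiv⟩, fun D' hD' =>
    huniq D' hD'.1 _ (hΦmem T hT) (hD'.2.symm.trans hequiv)⟩

end Statements
end
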